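/- Suppose γ : ℝ → ℝ is a non-constant smooth function with values in [−1,1] such that (γ')² = γ⁴ − (c₂+1)γ² + (c₂ − c₁²) for real constants c₁, c₂, and suppose there exists u₀ with γ'(u₀) ≠ 0. Then c₂ > c₁². -/

import Mathlib

theorem stmt2 (γ : ℝ → ℝ) (c₁ c₂ : ℝ) (hγ : ContDiff ℝ (⊤ : ℕ∞) γ)
    (hrange : ∀ u, -1 ≤ γ u ∧ γ u ≤ 1)
    (hnonconst : ¬ ∃ c : ℝ, ∀ u, γ u = c)
    (hode : ∀ u, (deriv γ u) ^ 2 = (γ u) ^ 4 - (c₂ + 1) * (γ u) ^ 2 + (c₂ - c₁ ^ 2))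
    (hu₀ : ∃ u₀, deriv γ u₀ ≠ 0) :
    c₂ > c₁ ^ 2 := by
  obtain ⟨u, hu⟩ := hu₀
  by_contra! hle
  have hpos : 0 < (deriv γ u) ^ 2 := by positivity
  have hsq : (γ u) ^ 2 ≤ 1 := by nlinarith [hrange u]
  -- The right-hand side is convex in `(γ u) ^ 2` and nonpositive at the endpoints `0` and `1`.
  have hconvex : (deriv γ u) ^ 2 =
      -((γ u) ^ 2 * (1 - (γ u) ^ 2)) - (1 - (γ u) ^ 2) * (c₁ ^ 2 - c₂) - (γ u) ^ 2 * c₁ ^ 2 := by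
    rw [hode u]; ring
  have h₁ : 0 ≤ (γ u) ^ 2 * (1 - (γ u) ^ 2) := mul_nonneg (sq_nonneg _) (by linarith)
  have h₂ : 0 ≤ (1 - (γ u) ^ 2) * (c₁ ^ 2 - c₂) := mul_nonneg (by linarith) (by linarith)
  have h₃ : 0 ≤ (γ u) ^ 2 * c₁ ^ 2 := by positivity
  linarith
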